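/- Let F be the centered Gaussian process with covariance E[F(s)F(t)] = (2π)^{-1/2}(√(t+s) − √|t−s|). For n ≥ 1 let ΔF_j = F(j/n) − F((j−1)/n). Then the signed cubic variation of F vanishes: for every T > 0 and every ε > 0, lim_{n→∞} P( max_{1 ≤ m ≤ ⌊nT⌋} | ∑_{j=1}^{m} ΔF_j³ | ≥ ε ) = 0; equivalently, the processes Z_n(t) = ∑_{j=1}^{⌊nt⌋} ΔF_j³ converge to 0 uniformly on compacts in probability. -/

import Mathlib

open MeasureTheory ProbabilityTheory Filter

/-- The covariance function `K(s,t) = (2π)^{-1/2}(√(t+s) − √|t−s|)`. -/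
noncomputable def covK (s t : ℝ) : ℝ :=
  (Real.sqrt (2 * Real.pi))⁻¹ * (Real.sqrt (t + s) - Real.sqrt |t - s|)

/-- `F` is the centered Gaussian process with covariance `covK`, on a probability
space `(Ω, P)`: every finite linear combination of values of `F` at nonnegative
times is centered Gaussian with the prescribed variance. -/
def IsHeatGaussian {Ω : Type*} [MeasurableSpace Ω] (P : Measure Ω)
    (F : ℝ → Ω → ℝ) : Prop :=
  IsProbabilityMeasure P ∧ (∀ t : ℝ, Measurable (F t)) ∧
  ∀ (m : ℕ) (ts : Fin m → ℝ) (c : Fin m → ℝ), (∀ i, 0 ≤ ts i) →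
    Measure.map (fun ω => ∑ i, c i * F (ts i) ω) P =
      gaussianReal 0 (Real.toNNReal (∑ i, ∑ j, c i * c j * covK (ts i) (ts j)))

/-- The `p`-th moment of the standard Gaussian distribution. -/
noncomputable def stdGaussianMoment (p : ℕ) : ℝ := ∫ x, x ^ p ∂(gaussianReal 0 1)

lemma stdGaussianMoment_two_mul_nonneg (q : ℕ) : 0 ≤ stdGaussianMoment (2 * q) :=
  integral_nonneg fun x => (even_two_mul q).pow_nonneg x

lemma integral_even_pow_gaussianReal (v : NNReal) (q : ℕ) :
    ∫ x, x ^ (2 * q) ∂(gaussianReal 0 v) = stdGaussianMoment (2 * q) * (v : ℝ) ^ q := by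
  have hmap : gaussianReal 0 v = (gaussianReal 0 1).map (Real.sqrt v * ·) := by
    rw [gaussianReal_map_const_mul]
    congr 1
    · simp
    · ext
      simp
  rw [hmap, integral_map (by fun_prop) (by fun_prop), stdGaussianMoment,
    ← integral_mul_const]
  refine integral_congr_ae (ae_of_all _ fun x => ?_)
  simp only [mul_pow]
  rw [pow_mul (Real.sqrt v), Real.sq_sqrt v.coe_nonneg, mul_comm]

section GaussianLaw

variable {Ω : Type*} [MeasurableSpace Ω] {P : Measure Ω} {X Y : Ω → ℝ}

lemma memLp_of_map_eq_gaussianReal (hX : Measurable X) {v : NNReal}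
    (h : P.map X = gaussianReal 0 v) (p : NNReal) : MemLp X p P := by
  have := memLp_id_gaussianReal (μ := 0) (v := v) p
  rw [← h] at this
  exact (memLp_map_measure_iff (by fun_prop) hX.aemeasurable).1 this

lemma integrable_pow_of_map_eq_gaussianReal (hX : Measurable X) {v : NNReal}
    (h : P.map X = gaussianReal 0 v) (p : ℕ) : Integrable (fun ω => X ω ^ p) P := by
  have hfin : IsProbabilityMeasure (P.map X) := h ▸ inferInstance
  have : IsProbabilityMeasure P := (Measure.isProbabilityMeasure_map_iff hX.aemeasurable).1 hfin
  have hm := memLp_of_map_eq_gaussianReal hX h p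
  have := MemLp.integrable_norm_pow' (p := p) (by simpa using hm)
  refine this.mono' (by fun_prop) (ae_of_all _ fun ω => by simp)

lemma integral_even_pow_of_map_eq_gaussianReal (hX : Measurable X) {v : NNReal}
    (h : P.map X = gaussianReal 0 v) (q : ℕ) :
    ∫ ω, X ω ^ (2 * q) ∂P = stdGaussianMoment (2 * q) * (v : ℝ) ^ q := by
  rw [← integral_even_pow_gaussianReal, ← h, integral_map hX.aemeasurable (by fun_prop)]

lemma memLp_cube_of_map_eq_gaussianReal (hX : Measurable X) {v : NNReal}
    (h : P.map X = gaussianReal 0 v) : MemLp (fun ω => X ω ^ 3) 2 P := by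
  rw [memLp_two_iff_integrable_sq (by fun_prop)]
  simpa only [← pow_mul] using integrable_pow_of_map_eq_gaussianReal hX h 6

/-- The quadratic form giving the variance in a family of Gaussian laws is nonnegative as soon as
its diagonal entries are, so that no truncation occurs in `Real.toNNReal`. -/
lemma quadratic_form_nonneg_of_map_eq_gaussianReal (hX : Measurable X) (hY : Measurable Y)
    {A B R : ℝ} (hA : 0 ≤ A) (hB : 0 ≤ B)
    (h : ∀ a b : ℝ, P.map (fun ω => a * X ω + b * Y ω) =
      gaussianReal 0 (Real.toNNReal (a ^ 2 * A + 2 * a * b * R + b ^ 2 * B))) (a b : ℝ) :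
    0 ≤ a ^ 2 * A + 2 * a * b * R + b ^ 2 * B := by
  have hm : stdGaussianMoment (2 * 1) = 1 := by
    have := variance_id_gaussianReal (μ := 0) (v := 1)
    rw [variance_eq_integral (by fun_prop)] at this
    simpa [stdGaussianMoment] using this
  have hint : ∀ a b : ℝ, Integrable (fun ω => (a * X ω + b * Y ω) ^ (2 * 1)) P := fun a b =>
    integrable_pow_of_map_eq_gaussianReal (by fun_prop) (h a b) _
  have hsq : ∀ a b : ℝ, ∫ ω, (a * X ω + b * Y ω) ^ (2 * 1) ∂P =
      max (a ^ 2 * A + 2 * a * b * R + b ^ 2 * B) 0 := fun a b => by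
    rw [integral_even_pow_of_map_eq_gaussianReal (by fun_prop) (h a b), hm]
    simp
  have hpar : ∫ ω, (a * X ω + b * Y ω) ^ (2 * 1) ∂P + ∫ ω, (a * X ω + (-b) * Y ω) ^ (2 * 1) ∂P
      = 2 * (a ^ 2 * ∫ ω, (1 * X ω + 0 * Y ω) ^ (2 * 1) ∂P) +
        2 * (b ^ 2 * ∫ ω, (0 * X ω + 1 * Y ω) ^ (2 * 1) ∂P) := by
    rw [← integral_add (hint _ _) (hint _ _)]
    simp only [← integral_const_mul]
    rw [← integral_add (((hint _ _).const_mul _).const_mul _)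
      (((hint _ _).const_mul _).const_mul _)]
    exact integral_congr_ae (ae_of_all _ fun ω => by ring)
  simp only [hsq] at hpar
  rw [max_eq_left (a := 1 ^ 2 * A + _ + _) (by linarith),
    max_eq_left (a := 0 ^ 2 * A + _ + _) (by linarith)] at hpar
  by_contra! hneg
  rw [max_eq_right hneg.le] at hpar
  rcases max_cases (a ^ 2 * A + 2 * a * (-b) * R + (-b) ^ 2 * B) 0 with ⟨he, _⟩ | ⟨he, _⟩ <;>
    rw [he] at hpar <;> nlinarith [mul_nonneg (sq_nonneg a) hA, mul_nonneg (sq_nonneg b) hB]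

/-- Polarisation of sixth moments: `E[X³Y³] = (m₆ / 5) (3ABR + 2R³)` for a centered Gaussian pair
with covariance matrix `[[A, R], [R, B]]`. -/
lemma integral_cube_mul_cube_of_map_eq_gaussianReal (hX : Measurable X) (hY : Measurable Y)
    {A B R : ℝ} (hA : 0 ≤ A) (hB : 0 ≤ B)
    (h : ∀ a b : ℝ, P.map (fun ω => a * X ω + b * Y ω) =
      gaussianReal 0 (Real.toNNReal (a ^ 2 * A + 2 * a * b * R + b ^ 2 * B))) :
    ∫ ω, X ω ^ 3 * Y ω ^ 3 ∂P = stdGaussianMoment 6 / 5 * (3 * A * B * R + 2 * R ^ 3) := by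
  have hint : ∀ a b : ℝ, Integrable (fun ω => (a * X ω + b * Y ω) ^ (2 * 3)) P := fun a b =>
    integrable_pow_of_map_eq_gaussianReal (by fun_prop) (h a b) _
  have hsix : ∀ a b : ℝ, ∫ ω, (a * X ω + b * Y ω) ^ (2 * 3) ∂P =
      stdGaussianMoment 6 * (a ^ 2 * A + 2 * a * b * R + b ^ 2 * B) ^ 3 := fun a b => by
    rw [integral_even_pow_of_map_eq_gaussianReal (by fun_prop) (h a b), Real.coe_toNNReal _
      (quadratic_form_nonneg_of_map_eq_gaussianReal hX hY hA hB h a b)]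
  have hpol : (fun ω => X ω ^ 3 * Y ω ^ 3) = fun ω =>
      34 / 720 * ((1 * X ω + 1 * Y ω) ^ (2 * 3) - (1 * X ω + (-1) * Y ω) ^ (2 * 3))
      - 1 / 720 * ((1 * X ω + 2 * Y ω) ^ (2 * 3) - (1 * X ω + (-2) * Y ω) ^ (2 * 3))
      - 1 / 720 * ((2 * X ω + 1 * Y ω) ^ (2 * 3) - (2 * X ω + (-1) * Y ω) ^ (2 * 3)) := by
    funext ω
    ring
  have hdiff : ∀ a b : ℝ, Integrable
      (fun ω => (a * X ω + b * Y ω) ^ (2 * 3) - (a * X ω + (-b) * Y ω) ^ (2 * 3)) P :=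
    fun a b => (hint a b).sub (hint a (-b))
  have hdiff₂ : Integrable (fun ω =>
      34 / 720 * ((1 * X ω + 1 * Y ω) ^ (2 * 3) - (1 * X ω + (-1) * Y ω) ^ (2 * 3))
      - 1 / 720 * ((1 * X ω + 2 * Y ω) ^ (2 * 3) - (1 * X ω + (-2) * Y ω) ^ (2 * 3))) P :=
    ((hdiff 1 1).const_mul _).sub ((hdiff 1 2).const_mul _)
  rw [hpol, integral_sub hdiff₂ ((hdiff 2 1).const_mul _),
    integral_sub ((hdiff 1 1).const_mul _) ((hdiff 1 2).const_mul _)]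
  simp only [integral_const_mul]
  rw [integral_sub (hint _ _) (hint _ _), integral_sub (hint _ _) (hint _ _),
    integral_sub (hint _ _) (hint _ _)]
  simp only [hsix]
  ring

end GaussianLaw

/-- The increment `√(x + 1) − √x`. -/
noncomputable def sqrtGap (x : ℝ) : ℝ := Real.sqrt (x + 1) - Real.sqrt x

lemma sqrtGap_nonneg (x : ℝ) : 0 ≤ sqrtGap x :=
  sub_nonneg.2 (Real.sqrt_le_sqrt (by linarith))

lemma sqrtGap_le_one {x : ℝ} (hx : 0 ≤ x) : sqrtGap x ≤ 1 := by
  rw [sqrtGap, sub_le_iff_le_add, Real.sqrt_le_left (by positivity)]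
  nlinarith [Real.sq_sqrt hx, Real.sqrt_nonneg x]

lemma sqrtGap_add_one_le {x : ℝ} (hx : 0 ≤ x) : sqrtGap (x + 1) ≤ sqrtGap x := by
  have h := Real.strictConcaveOn_sqrt.concaveOn.2 (show x ∈ Set.Ici 0 from hx)
    (show x + 1 + 1 ∈ Set.Ici 0 by simp; linarith) (show (0 : ℝ) ≤ 1 / 2 by norm_num)
    (show (0 : ℝ) ≤ 1 / 2 by norm_num) (by norm_num)
  simp only [smul_eq_mul] at h
  rw [show 1 / 2 * x + 1 / 2 * (x + 1 + 1) = x + 1 by ring] at h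
  rw [sqrtGap, sqrtGap]
  linarith

/-- The covariance of the increments of the process over `[k/n, (k+1)/n]` and
`[l/n, (l+1)/n]`. -/
noncomputable def incrementCov (n k l : ℕ) : ℝ :=
  covK ((k + 1 : ℝ) / n) ((l + 1 : ℝ) / n) - covK ((k + 1 : ℝ) / n) ((l : ℝ) / n) -
    covK ((k : ℝ) / n) ((l + 1 : ℝ) / n) + covK ((k : ℝ) / n) ((l : ℝ) / n)

/-- The scale `(2π)^{-1/2} n^{-1/2}` of the covariances of the increments. -/
noncomputable def covScale (n : ℕ) : ℝ := (Real.sqrt (2 * Real.pi))⁻¹ * (Real.sqrt n)⁻¹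

lemma covScale_nonneg (n : ℕ) : 0 ≤ covScale n := by
  unfold covScale
  positivity

lemma covScale_le (n : ℕ) : covScale n ≤ (Real.sqrt n)⁻¹ := by
  refine mul_le_of_le_one_left (by positivity) (inv_le_one_of_one_le₀ ?_)
  rw [Real.one_le_sqrt]
  linarith [Real.pi_gt_three]

lemma covK_div (n : ℕ) (x y : ℝ) :
    covK (x / n) (y / n) = covScale n * (Real.sqrt (y + x) - Real.sqrt |y - x|) := by
  have hn : (0 : ℝ) ≤ n := n.cast_nonneg
  rw [covK, covScale, ← add_div, ← sub_div, abs_div, abs_of_nonneg hn, Real.sqrt_div' _ hn,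
    Real.sqrt_div' _ hn]
  ring

lemma incrementCov_self (n k : ℕ) :
    incrementCov n k k = covScale n * (2 - (sqrtGap (2 * k) - sqrtGap (2 * k + 1))) := by
  simp only [incrementCov, covK_div, sqrtGap]
  rw [show (k : ℝ) + 1 - (k + 1) = 0 by ring, show (k : ℝ) - (k + 1) = -1 by ring,
    show (k : ℝ) + 1 - k = 1 by ring, show (k : ℝ) - k = 0 by ring,
    show (k : ℝ) + 1 + (k + 1) = 2 * k + 1 + 1 by ring, show (k : ℝ) + (k + 1) = 2 * k + 1 by ring,
    show (k : ℝ) + 1 + k = 2 * k + 1 by ring, show (k : ℝ) + k = 2 * k by ring]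
  simp only [abs_zero, abs_neg, abs_one, Real.sqrt_zero, Real.sqrt_one]
  ring

lemma incrementCov_of_eq_add (n k d : ℕ) :
    incrementCov n k (k + d + 1) = covScale n *
      (-(sqrtGap (2 * k + d + 1) - sqrtGap (2 * k + d + 1 + 1)) -
        (sqrtGap d - sqrtGap (d + 1))) := by
  simp only [incrementCov, covK_div, sqrtGap]
  push_cast
  rw [show (k : ℝ) + d + 1 + 1 - (k + 1) = d + 1 by ring,
    show (k : ℝ) + d + 1 - (k + 1) = d by ring,
    show (k : ℝ) + d + 1 + 1 - k = d + 1 + 1 by ring, show (k : ℝ) + d + 1 - k = d + 1 by ring,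
    abs_of_nonneg (by positivity), abs_of_nonneg (by positivity), abs_of_nonneg (by positivity),
    show (k : ℝ) + d + 1 + 1 + (k + 1) = 2 * k + d + 1 + 1 + 1 by ring,
    show (k : ℝ) + d + 1 + (k + 1) = 2 * k + d + 1 + 1 by ring,
    show (k : ℝ) + d + 1 + 1 + k = 2 * k + d + 1 + 1 by ring,
    show (k : ℝ) + d + 1 + k = 2 * k + d + 1 by ring]
  ring

lemma incrementCov_self_nonneg (n k : ℕ) : 0 ≤ incrementCov n k k := by
  rw [incrementCov_self]
  have h1 := sqrtGap_le_one (x := 2 * k) (by positivity)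
  have h2 := sqrtGap_nonneg (2 * k + 1)
  exact mul_nonneg (covScale_nonneg n) (by linarith)

lemma incrementCov_self_le (n k : ℕ) : incrementCov n k k ≤ 2 * covScale n := by
  rw [incrementCov_self, mul_comm]
  have h1 := sqrtGap_add_one_le (x := 2 * k) (by positivity)
  exact mul_le_mul_of_nonneg_right (by linarith) (covScale_nonneg n)

lemma abs_incrementCov_of_eq_add (n k d : ℕ) :
    |incrementCov n k (k + d + 1)| = covScale n *
      ((sqrtGap (2 * k + d + 1) - sqrtGap (2 * k + d + 1 + 1)) +
        (sqrtGap d - sqrtGap (d + 1))) := by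
  have h1 := sqrtGap_add_one_le (x := 2 * k + d + 1) (by positivity)
  have h2 := sqrtGap_add_one_le (x := d) (by positivity)
  rw [incrementCov_of_eq_add, abs_mul, abs_of_nonneg (covScale_nonneg n),
    abs_of_nonpos (by linarith)]
  ring

lemma abs_incrementCov_le {n k l : ℕ} (hkl : k < l) : |incrementCov n k l| ≤ 2 * covScale n := by
  obtain ⟨d, rfl⟩ : ∃ d, l = k + d + 1 := ⟨l - k - 1, by omega⟩
  have h1 := sqrtGap_le_one (x := 2 * k + d + 1) (by positivity)
  have h2 := sqrtGap_le_one (x := d) (by positivity)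
  have h3 := sqrtGap_nonneg (2 * k + d + 1 + 1)
  have h4 := sqrtGap_nonneg (d + 1)
  rw [abs_incrementCov_of_eq_add, mul_comm]
  exact mul_le_mul_of_nonneg_right (by linarith) (covScale_nonneg n)

lemma sum_abs_incrementCov_le (n l : ℕ) :
    ∑ k ∈ Finset.range l, |incrementCov n k l| ≤ 2 * covScale n := by
  have hterm : ∀ k ∈ Finset.range l, |incrementCov n k l| = covScale n *
      ((sqrtGap ((l + k : ℕ)) - sqrtGap ((l + (k + 1) : ℕ))) +
        (sqrtGap ((l - 1 - k : ℕ)) - sqrtGap ((l - 1 - k : ℕ) + 1))) := by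
    intro k hk
    obtain ⟨d, rfl⟩ : ∃ d, l = k + d + 1 := ⟨l - k - 1, by have := Finset.mem_range.1 hk; omega⟩
    rw [abs_incrementCov_of_eq_add, show k + d + 1 - 1 - k = d by omega]
    push_cast
    ring_nf
  have hrefl := Finset.sum_range_reflect (fun j : ℕ => sqrtGap j - sqrtGap ((j : ℝ) + 1)) l
  have htel := Finset.sum_range_sub' (fun j : ℕ => sqrtGap j) l
  push_cast at htel
  rw [Finset.sum_congr rfl hterm, ← Finset.mul_sum, Finset.sum_add_distrib, hrefl, htel,
    Finset.sum_range_sub' (fun k : ℕ => sqrtGap ((l + k : ℕ))), mul_comm]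
  have h1 := sqrtGap_le_one (x := ((l + 0 : ℕ) : ℝ)) (by positivity)
  have h2 := sqrtGap_nonneg ((l + l : ℕ) : ℝ)
  have h3 := sqrtGap_le_one (le_refl 0)
  have h4 := sqrtGap_nonneg (l : ℝ)
  refine mul_le_mul_of_nonneg_right ?_ (covScale_nonneg n)
  linarith

lemma covK_comm (s t : ℝ) : covK s t = covK t s := by
  rw [covK, covK, add_comm, abs_sub_comm]

/-- The increment of `F` over `[k/n, (k+1)/n]`. -/
noncomputable def increment {Ω : Type*} (F : ℝ → Ω → ℝ) (n k : ℕ) (ω : Ω) : ℝ :=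
  F ((k + 1 : ℝ) / n) ω - F ((k : ℝ) / n) ω

/-- The signed cubic variation of `F` over the first `m` intervals of the grid of mesh `1/n`. -/
noncomputable def cubicSum {Ω : Type*} (F : ℝ → Ω → ℝ) (n m : ℕ) (ω : Ω) : ℝ :=
  ∑ k ∈ Finset.range m, increment F n k ω ^ 3

lemma sum_Icc_cube_eq_cubicSum {Ω : Type*} (F : ℝ → Ω → ℝ) (n m : ℕ) (ω : Ω) :
    ∑ j ∈ Finset.Icc 1 m, (F ((j : ℝ) / n) ω - F (((j : ℝ) - 1) / n) ω) ^ 3 =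
      cubicSum F n m ω := by
  induction m with
  | zero => simp [cubicSum]
  | succ m ih =>
    rw [Finset.sum_Icc_succ_top (by omega), ih, cubicSum, cubicSum, Finset.sum_range_succ, increment]
    push_cast
    simp

namespace IsHeatGaussian

variable {Ω : Type*} [MeasurableSpace Ω] {P : Measure Ω} {F : ℝ → Ω → ℝ}

lemma measurable_increment (hF : IsHeatGaussian P F) (n k : ℕ) : Measurable (increment F n k) :=
  (hF.2.1 _).sub (hF.2.1 _)

lemma map_increment_pair (hF : IsHeatGaussian P F) (n k l : ℕ) (a b : ℝ) :
    P.map (fun ω => a * increment F n k ω + b * increment F n l ω) =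
      gaussianReal 0 (Real.toNNReal (a ^ 2 * incrementCov n k k +
        2 * a * b * incrementCov n k l + b ^ 2 * incrementCov n l l)) := by
  have h := hF.2.2 4 ![(k + 1 : ℝ) / n, (k : ℝ) / n, (l + 1 : ℝ) / n, (l : ℝ) / n] ![a, -a, b, -b]
    (fun i => by fin_cases i <;> simp <;> positivity)
  simp only [Fin.sum_univ_four, Matrix.cons_val] at h
  convert h using 3
  · simp only [increment]
    ring
  · simp only [incrementCov]
    rw [covK_comm ((l + 1 : ℝ) / n) ((k + 1 : ℝ) / n), covK_comm ((l + 1 : ℝ) / n) ((k : ℝ) / n),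
      covK_comm ((l : ℝ) / n) ((k + 1 : ℝ) / n), covK_comm ((l : ℝ) / n) ((k : ℝ) / n)]
    ring

lemma map_increment (hF : IsHeatGaussian P F) (n k : ℕ) :
    P.map (increment F n k) = gaussianReal 0 (Real.toNNReal (incrementCov n k k)) := by
  simpa using hF.map_increment_pair n k k 1 0

lemma integrable_increment_pow (hF : IsHeatGaussian P F) (n k p : ℕ) :
    Integrable (fun ω => increment F n k ω ^ p) P :=
  integrable_pow_of_map_eq_gaussianReal (hF.measurable_increment n k) (hF.map_increment n k) p

lemma integral_increment_even_pow_le (hF : IsHeatGaussian P F) (n k q : ℕ) :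
    ∫ ω, increment F n k ω ^ (2 * q) ∂P ≤
      stdGaussianMoment (2 * q) * (2 * covScale n) ^ q := by
  rw [integral_even_pow_of_map_eq_gaussianReal (hF.measurable_increment n k)
    (hF.map_increment n k), Real.coe_toNNReal _ (incrementCov_self_nonneg n k)]
  exact mul_le_mul_of_nonneg_left (pow_le_pow_left₀ (incrementCov_self_nonneg n k)
    (incrementCov_self_le n k) q) (stdGaussianMoment_two_mul_nonneg q)

lemma memLp_increment_cube (hF : IsHeatGaussian P F) (n k : ℕ) :
    MemLp (fun ω => increment F n k ω ^ 3) 2 P :=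
  memLp_cube_of_map_eq_gaussianReal (hF.measurable_increment n k) (hF.map_increment n k)

lemma memLp_cubicSum (hF : IsHeatGaussian P F) (n m : ℕ) : MemLp (cubicSum F n m) 2 P :=
  memLp_finsetSum _ fun k _ => hF.memLp_increment_cube n k

lemma integral_cube_mul_cube_le (hF : IsHeatGaussian P F) {n k l : ℕ} (hkl : k < l) :
    ∫ ω, increment F n k ω ^ 3 * increment F n l ω ^ 3 ∂P ≤
      4 * stdGaussianMoment 6 * covScale n ^ 2 * |incrementCov n k l| := by
  have hk := incrementCov_self_nonneg n k
  have hl := incrementCov_self_nonneg n l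
  have hs := covScale_nonneg n
  have hM : 0 ≤ stdGaussianMoment 6 := stdGaussianMoment_two_mul_nonneg 3
  rw [integral_cube_mul_cube_of_map_eq_gaussianReal (hF.measurable_increment n k)
    (hF.measurable_increment n l) hk hl (hF.map_increment_pair n k l)]
  have hprod : incrementCov n k k * incrementCov n l l ≤ 4 * covScale n ^ 2 := by
    nlinarith [mul_le_mul (incrementCov_self_le n k) (incrementCov_self_le n l) hl (by positivity)]
  have hsq : incrementCov n k l ^ 2 ≤ 4 * covScale n ^ 2 := by
    rw [← sq_abs]
    nlinarith [pow_le_pow_left₀ (abs_nonneg _) (abs_incrementCov_le (n := n) hkl) 2]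
  have hpoly : (3 * (incrementCov n k k * incrementCov n l l) + 2 * incrementCov n k l ^ 2) *
      incrementCov n k l ≤ 20 * covScale n ^ 2 * |incrementCov n k l| :=
    (mul_le_mul_of_nonneg_left (le_abs_self _) (by positivity)).trans
      (mul_le_mul_of_nonneg_right (by linarith) (abs_nonneg _))
  calc stdGaussianMoment 6 / 5 * (3 * incrementCov n k k * incrementCov n l l * incrementCov n k l +
        2 * incrementCov n k l ^ 3)
      = stdGaussianMoment 6 / 5 * ((3 * (incrementCov n k k * incrementCov n l l) +
          2 * incrementCov n k l ^ 2) * incrementCov n k l) := by ring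
    _ ≤ stdGaussianMoment 6 / 5 * (20 * covScale n ^ 2 * |incrementCov n k l|) :=
        mul_le_mul_of_nonneg_left hpoly (by positivity)
    _ = _ := by ring

lemma integral_cubicSum_sq_le (hF : IsHeatGaussian P F) (n m : ℕ) :
    ∫ ω, cubicSum F n m ω ^ 2 ∂P ≤ 24 * stdGaussianMoment 6 * covScale n ^ 3 * m := by
  induction m with
  | zero => simp [cubicSum]
  | succ m ih =>
    have hM : 0 ≤ stdGaussianMoment 6 := stdGaussianMoment_two_mul_nonneg 3
    have hs := covScale_nonneg n
    have hmul : ∀ k, Integrable (fun ω => increment F n k ω ^ 3 * increment F n m ω ^ 3) P :=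
      fun k => (hF.memLp_increment_cube n k).integrable_mul (hF.memLp_increment_cube n m)
    have hexp : (fun ω => cubicSum F n (m + 1) ω ^ 2) = fun ω => (cubicSum F n m ω ^ 2 +
        2 * ∑ k ∈ Finset.range m, increment F n k ω ^ 3 * increment F n m ω ^ 3) +
          increment F n m ω ^ (2 * 3) := by
      funext ω
      rw [← Finset.sum_mul, cubicSum, Finset.sum_range_succ, cubicSum]
      ring
    have hcross_int : Integrable (fun ω =>
        2 * ∑ k ∈ Finset.range m, increment F n k ω ^ 3 * increment F n m ω ^ 3) P :=
      (integrable_finsetSum _ fun k _ => hmul k).const_mul 2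
    have hsum_int : Integrable (fun ω => cubicSum F n m ω ^ 2 +
        2 * ∑ k ∈ Finset.range m, increment F n k ω ^ 3 * increment F n m ω ^ 3) P :=
      (hF.memLp_cubicSum n m).integrable_sq.add hcross_int
    have hcross : ∑ k ∈ Finset.range m,
        ∫ ω, increment F n k ω ^ 3 * increment F n m ω ^ 3 ∂P ≤
          4 * stdGaussianMoment 6 * covScale n ^ 2 * (2 * covScale n) := by
      refine (Finset.sum_le_sum fun k hk =>
        hF.integral_cube_mul_cube_le (Finset.mem_range.1 hk)).trans ?_
      rw [← Finset.mul_sum]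
      exact mul_le_mul_of_nonneg_left (sum_abs_incrementCov_le n m) (by positivity)
    have hdiag := hF.integral_increment_even_pow_le n m 3
    rw [hexp, integral_add hsum_int (hF.integrable_increment_pow n m _),
      integral_add (hF.memLp_cubicSum n m).integrable_sq hcross_int, integral_const_mul,
      integral_finsetSum _ fun k _ => hmul k]
    push_cast
    linear_combination ih + 2 * hcross + hdiag

end IsHeatGaussian

/-- Deterministic chaining over blocks of length `L`: the partial sums at multiples of `L` and the
fourth powers of the terms control all partial sums. -/
lemma one_le_of_le_abs_sum (x : ℕ → ℝ) {L m N : ℕ} (hL : 0 < L) (hm : m ≤ N) {ε : ℝ}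
    (hε : 0 < ε) (h : ε ≤ |∑ k ∈ Finset.range m, x k|) :
    1 ≤ (2 / ε) ^ 2 * ∑ q ∈ Finset.range (N / L + 1), (∑ k ∈ Finset.range (q * L), x k) ^ 2 +
      (2 / ε) ^ 4 * ((L : ℝ) ^ 3 * ∑ k ∈ Finset.range N, x k ^ 4) := by
  have hqm : m / L * L ≤ m := Nat.div_mul_le_self m L
  have hsplit := Finset.sum_range_add_sum_Ico x hqm
  have hA : (∑ k ∈ Finset.range (m / L * L), x k) ^ 2 ≤
      ∑ q ∈ Finset.range (N / L + 1), (∑ k ∈ Finset.range (q * L), x k) ^ 2 :=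
    Finset.single_le_sum (f := fun q => (∑ k ∈ Finset.range (q * L), x k) ^ 2)
      (fun _ _ => sq_nonneg _)
      (Finset.mem_range.2 (Nat.lt_succ_of_le (Nat.div_le_div_right hm)))
  have hB : (∑ k ∈ Finset.Ico (m / L * L) m, |x k|) ^ 4 ≤
      (L : ℝ) ^ 3 * ∑ k ∈ Finset.range N, x k ^ 4 := by
    refine (pow_sum_le_card_mul_sum_pow (fun _ _ => abs_nonneg _) 3).trans ?_
    have hcard : (Finset.Ico (m / L * L) m).card ≤ L := by
      have := Nat.div_add_mod' m L
      have := Nat.mod_lt m hL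
      rw [Nat.card_Ico]
      omega
    simp only [Nat.reduceAdd, (show Even 4 by decide).pow_abs]
    gcongr
    · intro k hk
      simp only [Finset.mem_Ico, Finset.mem_range] at hk ⊢
      omega
  have htri := abs_add_le (∑ k ∈ Finset.range (m / L * L), x k)
    (∑ k ∈ Finset.Ico (m / L * L) m, x k)
  rw [hsplit] at htri
  have habs := Finset.abs_sum_le_sum_abs x (Finset.Ico (m / L * L) m)
  have hA0 := (sq_nonneg _).trans hA
  have hB0 := ((show Even 4 by decide).pow_nonneg _).trans hB
  rcases le_total (ε / 2) |∑ k ∈ Finset.range (m / L * L), x k| with hc | hc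
  · have h1 : 1 ≤ (2 / ε) ^ 2 * (∑ k ∈ Finset.range (m / L * L), x k) ^ 2 := by
      rw [← sq_abs (∑ k ∈ _, _), ← mul_pow]
      refine one_le_pow₀ ?_
      calc (1 : ℝ) = 2 / ε * (ε / 2) := by field_simp
        _ ≤ _ := by gcongr
    have h2 := mul_le_mul_of_nonneg_left hA (sq_nonneg (2 / ε))
    have h3 := mul_nonneg (show 0 ≤ (2 / ε) ^ 4 by positivity) hB0
    linarith
  · have h1 : 1 ≤ (2 / ε) ^ 4 * (∑ k ∈ Finset.Ico (m / L * L) m, |x k|) ^ 4 := by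
      rw [← mul_pow]
      refine one_le_pow₀ ?_
      calc (1 : ℝ) = 2 / ε * (ε / 2) := by field_simp
        _ ≤ _ := by
          gcongr
          linarith
    have h2 := mul_le_mul_of_nonneg_left hB (show 0 ≤ (2 / ε) ^ 4 by positivity)
    have h3 := mul_nonneg (sq_nonneg (2 / ε)) hA0
    linarith

lemma IsHeatGaussian.measure_le_sup_cubicSum_le {Ω : Type*} [MeasurableSpace Ω] {P : Measure Ω}
    {F : ℝ → Ω → ℝ} (hF : IsHeatGaussian P F) (n N : ℕ) {L : ℕ} (hL : 0 < L) {ε : ℝ}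
    (hε : 0 < ε) :
    P {ω | ∃ m ≤ N, ε ≤ |cubicSum F n m ω|} ≤ ENNReal.ofReal
      ((2 / ε) ^ 2 * ((N / L + 1 : ℝ) * (24 * stdGaussianMoment 6 * covScale n ^ 3 * N)) +
        (2 / ε) ^ 4 * ((L : ℝ) ^ 3 * (N * (stdGaussianMoment 12 * (2 * covScale n) ^ 6)))) := by
  have := hF.1
  have hM : 0 ≤ stdGaussianMoment 6 := stdGaussianMoment_two_mul_nonneg 3
  have hs := covScale_nonneg n
  set W : Ω → ℝ := fun ω =>
    (2 / ε) ^ 2 * ∑ q ∈ Finset.range (N / L + 1), cubicSum F n (q * L) ω ^ 2 +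
      (2 / ε) ^ 4 * ((L : ℝ) ^ 3 * ∑ k ∈ Finset.range N, increment F n k ω ^ (2 * 6)) with hW
  have hsub : {ω | ∃ m ≤ N, ε ≤ |cubicSum F n m ω|} ⊆ {ω | 1 ≤ W ω} := by
    rintro ω ⟨m, hm, hω⟩
    have := one_le_of_le_abs_sum (fun k => increment F n k ω ^ 3) hL hm hε hω
    simp only [← pow_mul] at this
    exact this
  have hint₁ : ∀ q ∈ Finset.range (N / L + 1),
      Integrable (fun ω => cubicSum F n (q * L) ω ^ 2) P :=
    fun q _ => (hF.memLp_cubicSum n _).integrable_sq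
  have hint₂ : ∀ k ∈ Finset.range N, Integrable (fun ω => increment F n k ω ^ (2 * 6)) P :=
    fun k _ => hF.integrable_increment_pow n k _
  have hint₃ : Integrable (fun ω =>
      (2 / ε) ^ 2 * ∑ q ∈ Finset.range (N / L + 1), cubicSum F n (q * L) ω ^ 2) P :=
    (integrable_finsetSum _ hint₁).const_mul _
  have hint₄ : Integrable (fun ω =>
      (2 / ε) ^ 4 * ((L : ℝ) ^ 3 * ∑ k ∈ Finset.range N, increment F n k ω ^ (2 * 6))) P :=
    ((integrable_finsetSum _ hint₂).const_mul _).const_mul _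
  have hnonneg : ∀ ω, 0 ≤ W ω := fun ω => by
    have : ∀ k, 0 ≤ increment F n k ω ^ (2 * 6) := fun k => (even_two_mul 6).pow_nonneg _
    have := Finset.sum_nonneg fun k (_ : k ∈ Finset.range N) => this k
    positivity
  have hmarkov := mul_meas_ge_le_integral_of_nonneg (ae_of_all P hnonneg) (hint₃.add hint₄) 1
  have hsum₁ : ∑ q ∈ Finset.range (N / L + 1), ∫ ω, cubicSum F n (q * L) ω ^ 2 ∂P ≤
      (N / L + 1 : ℝ) * (24 * stdGaussianMoment 6 * covScale n ^ 3 * N) := by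
    have hterm : ∀ q ∈ Finset.range (N / L + 1), ∫ ω, cubicSum F n (q * L) ω ^ 2 ∂P ≤
        24 * stdGaussianMoment 6 * covScale n ^ 3 * N := fun q hq => by
      have hqN : q * L ≤ N := (Nat.le_div_iff_mul_le hL).1 (Finset.mem_range_succ_iff.1 hq)
      refine (hF.integral_cubicSum_sq_le n _).trans ?_
      gcongr
    refine (Finset.sum_le_card_nsmul _ _ _ hterm).trans ?_
    rw [Finset.card_range, nsmul_eq_mul]
    refine mul_le_mul_of_nonneg_right ?_ (by positivity)
    push_cast
    gcongr
    exact Nat.cast_div_le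
  have hsum₂ : ∑ k ∈ Finset.range N, ∫ ω, increment F n k ω ^ (2 * 6) ∂P ≤
      N * (stdGaussianMoment 12 * (2 * covScale n) ^ 6) := by
    refine (Finset.sum_le_card_nsmul _ _ _
      fun k _ => hF.integral_increment_even_pow_le n k 6).trans_eq ?_
    rw [Finset.card_range, nsmul_eq_mul]
  refine (measure_mono hsub).trans ?_
  rw [← ofReal_measureReal]
  refine ENNReal.ofReal_le_ofReal ?_
  rw [one_mul] at hmarkov
  refine hmarkov.trans ?_
  rw [hW, integral_add hint₃ hint₄, integral_const_mul, integral_const_mul, integral_const_mul,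
    integral_finsetSum _ hint₁, integral_finsetSum _ hint₂]
  gcongr

/-- The bound of `IsHeatGaussian.measure_le_sup_cubicSum_le` with blocks of length of order
`n ^ (3 / 5)`, written in terms of `y = n ^ (1 / 10)`. -/
lemma block_bound_le {a b A B s T y L N : ℝ} (ha : 0 ≤ a) (hb : 0 ≤ b) (hA : 0 ≤ A) (hB : 0 ≤ B)
    (hs : 0 ≤ s) (hT : 0 ≤ T) (hy : 1 ≤ y) (hN : 0 ≤ N) (hsy : s ≤ (y ^ 5)⁻¹)
    (hNy : N ≤ y ^ 10 * T) (hyL : y ^ 6 ≤ L) (hLy : L ≤ 2 * y ^ 6) :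
    a * ((N / L + 1) * (24 * A * s ^ 3 * N)) + b * (L ^ 3 * (N * (B * (2 * s) ^ 6))) ≤
      (a * ((T + 1) * (24 * A * T)) + b * (512 * B * T)) * y⁻¹ := by
  have hy0 : 0 < y := by linarith
  have hL0 : 0 < L := lt_of_lt_of_le (by positivity) hyL
  have hblocks : N / L + 1 ≤ y ^ 4 * (T + 1) := by
    have h1 : N / L ≤ y ^ 4 * T := by
      rw [div_le_iff₀ hL0]
      calc N ≤ y ^ 4 * T * y ^ 6 := by linarith [show y ^ 4 * T * y ^ 6 = y ^ 10 * T by ring]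
        _ ≤ _ := by gcongr
    have h2 : 1 ≤ y ^ 4 := one_le_pow₀ hy
    linarith
  have hfst : (N / L + 1) * (24 * A * s ^ 3 * N) ≤ (T + 1) * (24 * A * T) * y⁻¹ := by
    calc (N / L + 1) * (24 * A * s ^ 3 * N)
        ≤ (y ^ 4 * (T + 1)) * (24 * A * (y ^ 5)⁻¹ ^ 3 * (y ^ 10 * T)) := by gcongr
      _ = _ := by field_simp
  have hsnd : L ^ 3 * (N * (B * (2 * s) ^ 6)) ≤ 512 * B * T * y⁻¹ := by
    calc L ^ 3 * (N * (B * (2 * s) ^ 6))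
        ≤ (2 * y ^ 6) ^ 3 * ((y ^ 10 * T) * (B * (2 * (y ^ 5)⁻¹) ^ 6)) := by gcongr
      _ = 512 * B * T * y⁻¹ * y⁻¹ := by
        field_simp
        ring
      _ ≤ 512 * B * T * y⁻¹ :=
        mul_le_of_le_one_right (by positivity) (inv_le_one_of_one_le₀ hy)
  linarith [mul_le_mul_of_nonneg_left hfst ha, mul_le_mul_of_nonneg_left hsnd hb]

/-- Proposition 4.2: the signed cubic variation of `F` vanishes. The processes
`Z_n(t) = ∑_{j=1}^{⌊nt⌋} ΔF_j³`, with `ΔF_j = F(j/n) − F((j−1)/n)`, converge to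
`0` uniformly on compacts in probability: for every `T > 0` and `ε > 0`,
`P(max_{1 ≤ m ≤ ⌊nT⌋} |∑_{j=1}^m ΔF_j³| ≥ ε) → 0` as `n → ∞`. -/
theorem signed_cubic_variation_vanishes {Ω : Type*} [MeasurableSpace Ω]
    (P : Measure Ω) (F : ℝ → Ω → ℝ) (hF : IsHeatGaussian P F)
    (T : ℝ) (hT : 0 < T) (ε : ℝ) (hε : 0 < ε) :
    Tendsto (fun n : ℕ =>
        P {ω : Ω | ε ≤ (Finset.range (⌊(n : ℝ) * T⌋₊ + 1)).sup' ⟨0, by simp⟩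
            (fun m => |∑ j ∈ Finset.Icc 1 m,
              (F ((j : ℝ) / n) ω - F (((j : ℝ) - 1) / n) ω) ^ 3|)})
      atTop (nhds 0) := by
  let C : ℝ := (2 / ε) ^ 2 * ((T + 1) * (24 * stdGaussianMoment 6 * T)) +
    (2 / ε) ^ 4 * (512 * stdGaussianMoment 12 * T)
  have hlim : Tendsto (fun n : ℕ => ENNReal.ofReal (C * ((n : ℝ) ^ (1 / 10 : ℝ))⁻¹)) atTop
      (nhds 0) := by
    have h := ((tendsto_rpow_atTop (show (0 : ℝ) < 1 / 10 by norm_num)).comp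
      tendsto_natCast_atTop_atTop).inv_tendsto_atTop.const_mul C
    rw [mul_zero] at h
    simpa using ENNReal.tendsto_ofReal h
  refine tendsto_of_tendsto_of_tendsto_of_le_of_le' tendsto_const_nhds hlim
    (Eventually.of_forall fun _ => bot_le) ?_
  filter_upwards [eventually_ge_atTop 1] with n hn
  have hn1 : (1 : ℝ) ≤ n := by exact_mod_cast hn
  set y : ℝ := (n : ℝ) ^ (1 / 10 : ℝ) with hy
  have hy1 : 1 ≤ y := Real.one_le_rpow hn1 (by norm_num)
  have hyn : y ^ 10 = n := by
    rw [hy, ← Real.rpow_natCast, ← Real.rpow_mul (by positivity)]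
    norm_num
  have hsqrt : Real.sqrt n = y ^ 5 := by
    rw [← hyn, show y ^ 10 = (y ^ 5) ^ 2 by ring, Real.sqrt_sq (by positivity)]
  have hy6 : 1 ≤ y ^ 6 := one_le_pow₀ hy1
  have hceil := Nat.le_ceil (y ^ 6)
  have hL : 0 < ⌈y ^ 6⌉₊ := Nat.ceil_pos.2 (by positivity)
  have hset : {ω : Ω | ε ≤ (Finset.range (⌊(n : ℝ) * T⌋₊ + 1)).sup' ⟨0, by simp⟩
      (fun m => |∑ j ∈ Finset.Icc 1 m,
        (F ((j : ℝ) / n) ω - F (((j : ℝ) - 1) / n) ω) ^ 3|)} =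
      {ω | ∃ m ≤ ⌊(n : ℝ) * T⌋₊, ε ≤ |cubicSum F n m ω|} := by
    ext ω
    simp only [Set.mem_ofPred_eq, sum_Icc_cube_eq_cubicSum]
    refine (Finset.le_sup'_iff _).trans ?_
    simp only [Finset.mem_range_succ_iff]
  rw [hset]
  refine (hF.measure_le_sup_cubicSum_le n _ hL hε).trans (ENNReal.ofReal_le_ofReal ?_)
  refine block_bound_le (by positivity) (by positivity) (stdGaussianMoment_two_mul_nonneg 3)
    (stdGaussianMoment_two_mul_nonneg 6) (covScale_nonneg n) hT.le hy1 (by positivity)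
    (hsqrt ▸ covScale_le n) ?_ hceil ?_
  · rw [hyn]
    exact Nat.floor_le (by positivity)
  · linarith [Nat.ceil_lt_add_one (show 0 ≤ y ^ 6 by positivity)]
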